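/- Let L be a convex cone of real bounded random variables on (Ω, 𝒜, P₀). The following are equivalent: (i) there is a constant k ≥ 0 such that E_{P₀}(X) ≤ k·ess sup(−X) for every X ∈ L; (ii) there exist a monotone normalized linear functional ℓ : B → ℝ with ℓ ~ P₀ and ℓ(X) ≤ 0 for every X ∈ L, and a constant r > 0 such that ℓ(1_A) ≥ r·P₀(A) for every A ∈ 𝒜. -/

import Mathlib

open MeasureTheory Filter Topology

/-- A bounded measurable real function on `Ω`: an element of the space `B`. -/
def IsBddMeas {Ω : Type*} [MeasurableSpace Ω] (f : Ω → ℝ) : Prop :=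
  Measurable f ∧ ∃ M : ℝ, ∀ ω, |f ω| ≤ M

/-- A finitely additive probability on `𝒜`, encoded as a functional on functions
`Ω → ℝ` that is linear and monotone on the space `B` of bounded measurable functions
and normalized (`ℓ(1) = 1`). -/
def IsFAP {Ω : Type*} [MeasurableSpace Ω] (ℓ : (Ω → ℝ) → ℝ) : Prop :=
  (∀ f g : Ω → ℝ, IsBddMeas f → IsBddMeas g → ℓ (f + g) = ℓ f + ℓ g) ∧
  (∀ (c : ℝ) (f : Ω → ℝ), IsBddMeas f → ℓ (c • f) = c * ℓ f) ∧
  (∀ f g : Ω → ℝ, IsBddMeas f → IsBddMeas g → (∀ ω, f ω ≤ g ω) → ℓ f ≤ ℓ g) ∧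
  ℓ (fun _ => 1) = 1

/-- The essential supremum `ess sup(X) = inf {x ∈ ℝ : P₀(X > x) = 0}` of a real random
variable `X` with respect to `P₀` (finite when `X` is bounded). -/
noncomputable def essSupR {Ω : Type*} [MeasurableSpace Ω] (P₀ : MeasureTheory.Measure Ω)
    (X : Ω → ℝ) : ℝ :=
  sInf {x : ℝ | P₀ {ω | x < X ω} = 0}

theorem IsBddMeas.add {Ω : Type*} [MeasurableSpace Ω] {f g : Ω → ℝ} (hf : IsBddMeas f)
    (hg : IsBddMeas g) : IsBddMeas (f + g) := by
  obtain ⟨hf, M, hM⟩ := hf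
  obtain ⟨hg, N, hN⟩ := hg
  exact ⟨hf.add hg, M + N, fun ω => (abs_add_le _ _).trans (add_le_add (hM ω) (hN ω))⟩

theorem IsBddMeas.smul {Ω : Type*} [MeasurableSpace Ω] {f : Ω → ℝ} (c : ℝ) (hf : IsBddMeas f) :
    IsBddMeas (c • f) := by
  obtain ⟨hf, M, hM⟩ := hf
  refine ⟨hf.const_smul c, |c| * M, fun ω => ?_⟩
  simp only [Pi.smul_apply, smul_eq_mul, abs_mul]
  exact mul_le_mul_of_nonneg_left (hM ω) (abs_nonneg c)

theorem isBddMeas_const {Ω : Type*} [MeasurableSpace Ω] (c : ℝ) :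
    IsBddMeas (fun _ : Ω => c) :=
  ⟨measurable_const, |c|, fun _ => le_rfl⟩

theorem isBddMeas_indicator {Ω : Type*} [MeasurableSpace Ω] {A : Set Ω} (hA : MeasurableSet A) :
    IsBddMeas (A.indicator fun _ => (1 : ℝ)) := by
  refine ⟨measurable_const.indicator hA, 1, fun ω => ?_⟩
  by_cases h : ω ∈ A <;> simp [h]

theorem IsBddMeas.integrable {Ω : Type*} [MeasurableSpace Ω] {f : Ω → ℝ} (hf : IsBddMeas f)
    (P : Measure Ω) [IsFiniteMeasure P] : Integrable f P := by
  obtain ⟨hf, M, hM⟩ := hf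
  exact Integrable.of_bound hf.aestronglyMeasurable M (ae_of_all _ hM)

/-- The space of bounded measurable real functions, as a submodule of all functions. -/
def bddMeasSubmodule (Ω : Type*) [MeasurableSpace Ω] : Submodule ℝ (Ω → ℝ) where
  carrier := {f | IsBddMeas f}
  add_mem' := IsBddMeas.add
  zero_mem' := isBddMeas_const 0
  smul_mem' c _ := IsBddMeas.smul c

/-- The values `x` in the definition of `essSupR` of `-X` are those with `X + x ≥ 0` a.e. -/
theorem measure_lt_neg_eq_zero_iff {Ω : Type*} [MeasurableSpace Ω] (P : Measure Ω) (X : Ω → ℝ)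
    (t : ℝ) : P {ω | t < -X ω} = 0 ↔ ∀ᵐ ω ∂P, 0 ≤ X ω + t := by
  rw [ae_iff]
  have : {ω | t < -X ω} = {ω | ¬ 0 ≤ X ω + t} := by
    ext ω
    simp only [Set.mem_ofPred_eq, not_le]
    constructor <;> intro h <;> linarith
  rw [this]

theorem essSupR_neg_le {Ω : Type*} [MeasurableSpace Ω] (P : Measure Ω) [IsProbabilityMeasure P]
    {X : Ω → ℝ} (hX : IsBddMeas X) {t : ℝ} (ht : ∀ᵐ ω ∂P, 0 ≤ X ω + t) :
    essSupR P (fun ω => -X ω) ≤ t := by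
  obtain ⟨-, M, hM⟩ := hX
  refine csInf_le ⟨-M, fun x hx => ?_⟩ ((measure_lt_neg_eq_zero_iff P X t).2 ht)
  obtain ⟨ω, hω⟩ := ((measure_lt_neg_eq_zero_iff P X x).1 hx).exists
  linarith [(abs_le.1 (hM ω)).2]

theorem le_essSupR_neg {Ω : Type*} [MeasurableSpace Ω] (P : Measure Ω)
    {X : Ω → ℝ} (hX : IsBddMeas X) {a : ℝ}
    (ha : ∀ t, (∀ᵐ ω ∂P, 0 ≤ X ω + t) → a ≤ t) :
    a ≤ essSupR P (fun ω => -X ω) := by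
  obtain ⟨-, M, hM⟩ := hX
  refine le_csInf ⟨M, (measure_lt_neg_eq_zero_iff P X M).2 (ae_of_all _ fun ω => ?_)⟩
    fun t ht => ha t ((measure_lt_neg_eq_zero_iff P X t).1 ht)
  linarith [(abs_le.1 (hM ω)).1]

/-- Bisecting the range: a lower bound on indicators extends, up to an error `r M / 2 ^ n`, to
functions with values in `[0, M]`. -/
theorem IsFAP.mul_integral_sub_le {Ω : Type*} [MeasurableSpace Ω] {ℓ : (Ω → ℝ) → ℝ}
    (hℓ : IsFAP ℓ) (P : Measure Ω) [IsProbabilityMeasure P] {r : ℝ} (hr : 0 < r)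
    (h : ∀ A : Set Ω, MeasurableSet A → r * (P A).toReal ≤ ℓ (A.indicator fun _ => (1 : ℝ)))
    (n : ℕ) : ∀ (f : Ω → ℝ) (M : ℝ), Measurable f → (∀ ω, 0 ≤ f ω) → (∀ ω, f ω ≤ M) →
      r * ∫ ω, f ω ∂P - r * M / 2 ^ n ≤ ℓ f := by
  obtain ⟨hadd, hsmul, hmono, -⟩ := hℓ
  induction n with
  | zero =>
    intro f M hf h0 hM
    have hfb : IsBddMeas f := ⟨hf, M, fun ω => abs_le.2 ⟨by linarith [h0 ω, hM ω], hM ω⟩⟩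
    have h1 : ∫ ω, f ω ∂P ≤ M := by
      simpa using integral_mono (hfb.integrable P) (integrable_const M) hM
    have h2 := hsmul 0 f hfb
    have h3 := hmono (0 • f) f (hfb.smul 0) hfb fun ω => by simpa using h0 ω
    have h4 := mul_le_mul_of_nonneg_left h1 hr.le
    simp only [zero_smul, zero_mul] at h2 h3
    simp only [pow_zero, div_one]
    linarith
  | succ n ih =>
    intro f M hf h0 hM
    set A : Set Ω := {ω | M / 2 ≤ f ω}
    have hA : MeasurableSet A := measurableSet_le measurable_const hf
    set s : Ω → ℝ := (M / 2) • A.indicator fun _ => (1 : ℝ)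
    have hs : IsBddMeas s := (isBddMeas_indicator hA).smul _
    have hfb : IsBddMeas f := ⟨hf, M, fun ω => abs_le.2 ⟨by linarith [h0 ω, hM ω], hM ω⟩⟩
    have hg : IsBddMeas (f + (-1 : ℝ) • s) := hfb.add (hs.smul _)
    have hval : ∀ ω, 0 ≤ (f + (-1 : ℝ) • s) ω ∧ (f + (-1 : ℝ) • s) ω ≤ M / 2 := by
      intro ω
      by_cases hω : ω ∈ A
      · have hω' : M / 2 ≤ f ω := hω
        simp only [s, Pi.add_apply, Pi.smul_apply, Set.indicator_of_mem hω, smul_eq_mul]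
        constructor <;> linarith [hM ω]
      · have hω' : f ω < M / 2 := not_le.1 hω
        simp only [s, Pi.add_apply, Pi.smul_apply, Set.indicator_of_notMem hω, smul_eq_mul]
        constructor <;> linarith [h0 ω]
    have hM0 : 0 ≤ M / 2 := by
      obtain ⟨ω⟩ := nonempty_of_isProbabilityMeasure P
      linarith [h0 ω, hM ω]
    have h1 := ih _ (M / 2) hg.1 (fun ω => (hval ω).1) fun ω => (hval ω).2
    have hfs : f = (f + (-1 : ℝ) • s) + s := by
      ext ω
      simp
    have h2 : ℓ f = ℓ (f + (-1 : ℝ) • s) + ℓ s := by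
      rw [← hadd _ _ hg hs, ← hfs]
    have h3 : ∫ ω, f ω ∂P = ∫ ω, (f + (-1 : ℝ) • s) ω ∂P + ∫ ω, s ω ∂P := by
      rw [← integral_add (hg.integrable P) (hs.integrable P)]
      exact integral_congr_ae (ae_of_all _ fun ω => congrFun hfs ω)
    have h4 : ∫ ω, s ω ∂P = M / 2 * (P A).toReal := by
      simp only [s, Pi.smul_apply, smul_eq_mul, integral_const_mul]
      congr 1
      exact integral_indicator_one hA
    have h5 : ℓ s = M / 2 * ℓ (A.indicator fun _ => (1 : ℝ)) :=
      hsmul _ _ (isBddMeas_indicator hA)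
    have h6 := mul_le_mul_of_nonneg_left (h A hA) hM0
    have h7 : r * M / 2 ^ (n + 1) = r * (M / 2) / 2 ^ n := by
      rw [pow_succ]; field_simp
    rw [h2, h3, h4, h5, h7]
    linarith

theorem IsFAP.mul_integral_le {Ω : Type*} [MeasurableSpace Ω] {ℓ : (Ω → ℝ) → ℝ}
    (hℓ : IsFAP ℓ) (P : Measure Ω) [IsProbabilityMeasure P] {r : ℝ} (hr : 0 < r)
    (h : ∀ A : Set Ω, MeasurableSet A → r * (P A).toReal ≤ ℓ (A.indicator fun _ => (1 : ℝ)))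
    {f : Ω → ℝ} (hf : IsBddMeas f) (h0 : ∀ ω, 0 ≤ f ω) : r * ∫ ω, f ω ∂P ≤ ℓ f := by
  obtain ⟨hf, M, hM⟩ := hf
  have hlim : Tendsto (fun n : ℕ => r * ∫ ω, f ω ∂P - r * M / 2 ^ n) atTop
      (𝓝 (r * ∫ ω, f ω ∂P - 0)) :=
    tendsto_const_nhds.sub
      (tendsto_const_nhds.div_atTop (tendsto_pow_atTop_atTop_of_one_lt one_lt_two))
  rw [sub_zero] at hlim
  exact le_of_tendsto' hlim fun n =>
    hℓ.mul_integral_sub_le P hr h n f M hf h0 fun ω => (le_abs_self _).trans (hM ω)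

/-- If `ℓ` vanishes on null sets, then `ℓ` only sees functions up to null sets. -/
theorem IsFAP.le_of_ae_le {Ω : Type*} [MeasurableSpace Ω] {ℓ : (Ω → ℝ) → ℝ}
    (hℓ : IsFAP ℓ) (P : Measure Ω)
    (h : ∀ A : Set Ω, MeasurableSet A → P A = 0 → ℓ (A.indicator fun _ => (1 : ℝ)) = 0)
    {f g : Ω → ℝ} (hf : IsBddMeas f) (hg : IsBddMeas g) (hfg : ∀ᵐ ω ∂P, f ω ≤ g ω) :
    ℓ f ≤ ℓ g := by
  obtain ⟨hadd, hsmul, hmono, -⟩ := hℓ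
  obtain ⟨M, hM⟩ := hf.2
  obtain ⟨N, hN⟩ := hg.2
  set A : Set Ω := {ω | g ω < f ω}
  have hA : MeasurableSet A := measurableSet_lt hg.1 hf.1
  have hPA : P A = 0 := by
    rw [ae_iff] at hfg
    simpa only [not_le] using hfg
  have hi := isBddMeas_indicator hA
  have h1 := hmono f (g + (M + N) • A.indicator fun _ => (1 : ℝ)) hf (hg.add (hi.smul _)) ?_
  · rw [hadd _ _ hg (hi.smul _), hsmul _ _ hi, h A hA hPA, mul_zero, add_zero] at h1
    exact h1
  · intro ω
    by_cases hω : ω ∈ A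
    · simp only [Pi.add_apply, Pi.smul_apply, Set.indicator_of_mem hω, smul_eq_mul]
      linarith [(abs_le.1 (hM ω)).2, (abs_le.1 (hN ω)).1]
    · simp only [Pi.add_apply, Pi.smul_apply, Set.indicator_of_notMem hω, smul_eq_mul]
      linarith [not_lt.1 (show ¬ g ω < f ω from hω)]

/-- If `ℓ ≥ r P` and `ℓ X ≤ 0`, then `r E(X) ≤ ess sup (-X)`. -/
theorem IsFAP.mul_integral_le_essSupR_neg {Ω : Type*} [MeasurableSpace Ω] {ℓ : (Ω → ℝ) → ℝ}
    (hℓ : IsFAP ℓ) (P : Measure Ω) [IsProbabilityMeasure P] {r : ℝ} (hr : 0 < r)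
    (h : ∀ A : Set Ω, MeasurableSet A → r * (P A).toReal ≤ ℓ (A.indicator fun _ => (1 : ℝ)))
    (hnull : ∀ A : Set Ω, MeasurableSet A → P A = 0 → ℓ (A.indicator fun _ => (1 : ℝ)) = 0)
    {X : Ω → ℝ} (hX : IsBddMeas X) (hℓX : ℓ X ≤ 0) :
    r * ∫ ω, X ω ∂P ≤ essSupR P (fun ω => -X ω) := by
  refine le_essSupR_neg P hX fun t ht => ?_
  have hc := (isBddMeas_const (Ω := Ω) 1).smul t
  have hXt : IsBddMeas (X + t • fun _ => (1 : ℝ)) := hX.add hc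
  have hpos : IsBddMeas (fun ω => max (X ω + t) 0) := by
    obtain ⟨M, hM⟩ := hX.2
    refine ⟨(hX.1.add_const t).max measurable_const, M + |t|, fun ω => ?_⟩
    rw [abs_of_nonneg (le_max_right _ _)]
    have := abs_le.1 (hM ω)
    exact max_le (by linarith [le_abs_self t]) (by linarith [abs_nonneg t])
  have h1 := hℓ.mul_integral_le P hr h hpos fun ω => le_max_right _ _
  have h2 := hℓ.le_of_ae_le P hnull hpos hXt (ht.mono fun ω hω => by simpa using hω)
  have h3 : ∫ ω, max (X ω + t) 0 ∂P = ∫ ω, X ω ∂P + t := by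
    rw [integral_congr_ae (g := fun ω => X ω + t) (ht.mono fun ω hω => max_eq_left hω),
      integral_add (hX.integrable P) (integrable_const t)]
    simp
  have h4 : 0 ≤ ∫ ω, max (X ω + t) 0 ∂P := integral_nonneg fun ω => le_max_right _ _
  have h5 := mul_nonneg hr.le h4
  rw [hℓ.1 _ _ hX hc, hℓ.2.1 _ _ (isBddMeas_const 1), hℓ.2.2.2] at h2
  have h6 : 0 ≤ t := by linarith
  have h7 := mul_nonneg hr.le h6
  rw [h3] at h1
  linarith

/-- The bounded functions `f` with `ess sup (-f - X) ≤ t` and `k t ≤ E(f + X)` for some `X` in the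
cone `L` and some `t`. -/
def separationCone {Ω : Type*} [MeasurableSpace Ω] (P : Measure Ω) [IsFiniteMeasure P]
    (L : Set (Ω → ℝ)) (k : ℝ) (h0 : 0 ∈ L) (hL : ∀ X ∈ L, IsBddMeas X)
    (hLadd : ∀ X ∈ L, ∀ Y ∈ L, X + Y ∈ L) (hLsmul : ∀ X ∈ L, ∀ c : ℝ, 0 ≤ c → c • X ∈ L) :
    PointedCone ℝ (bddMeasSubmodule Ω) where
  carrier := {f | ∃ X ∈ L, ∃ t : ℝ, (∀ᵐ ω ∂P, 0 ≤ f.1 ω + X ω + t) ∧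
    k * t ≤ ∫ ω, f.1 ω ∂P + ∫ ω, X ω ∂P}
  zero_mem' := ⟨0, h0, 0, by simp, by simp⟩
  smul_mem' := by
    rintro ⟨c, hc⟩ f ⟨X, hX, t, hae, hk⟩
    change ∃ Y ∈ L, ∃ t : ℝ, (∀ᵐ ω ∂P, 0 ≤ (c • f).1 ω + Y ω + t) ∧
      k * t ≤ ∫ ω, (c • f).1 ω ∂P + ∫ ω, Y ω ∂P
    refine ⟨c • X, hLsmul X hX c hc, c * t, hae.mono fun ω hω => ?_, ?_⟩
    · have := mul_nonneg hc hω
      simp only [Submodule.coe_smul, Pi.smul_apply, smul_eq_mul]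
      linarith
    · have := mul_le_mul_of_nonneg_left hk hc
      simp only [Submodule.coe_smul, Pi.smul_apply, smul_eq_mul, integral_const_mul]
      linarith
  add_mem' := by
    rintro f g ⟨X, hX, t, hae, hk⟩ ⟨Y, hY, u, hae', hk'⟩
    refine ⟨X + Y, hLadd X hX Y hY, t + u, ?_, ?_⟩
    · filter_upwards [hae, hae'] with ω h1 h2
      simp only [Submodule.coe_add, Pi.add_apply]
      linarith
    · simp only [Submodule.coe_add, Pi.add_apply]
      rw [integral_add (IsBddMeas.integrable f.2 P) (IsBddMeas.integrable g.2 P),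
        integral_add ((hL X hX).integrable P) ((hL Y hY).integrable P)]
      linarith

/-- The M. Riesz extension of `c ↦ c` on the constants that is nonnegative on the separation
cone, extended linearly to all functions. -/
theorem exists_linearMap_nonneg_on_separationCone {Ω : Type*} [MeasurableSpace Ω] (P : Measure Ω)
    [IsProbabilityMeasure P] (L : Set (Ω → ℝ)) {k : ℝ} (hk : 0 ≤ k) (h0 : 0 ∈ L)
    (hL : ∀ X ∈ L, IsBddMeas X)
    (hLadd : ∀ X ∈ L, ∀ Y ∈ L, X + Y ∈ L) (hLsmul : ∀ X ∈ L, ∀ c : ℝ, 0 ≤ c → c • X ∈ L)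
    (hLk : ∀ X ∈ L, ∀ t : ℝ, (∀ᵐ ω ∂P, 0 ≤ X ω + t) → ∫ ω, X ω ∂P ≤ k * t) :
    ∃ ℓ : (Ω → ℝ) →ₗ[ℝ] ℝ, ℓ (fun _ => 1) = 1 ∧
      ∀ f : bddMeasSubmodule Ω, f ∈ separationCone P L k h0 hL hLadd hLsmul → 0 ≤ ℓ f := by
  let e : bddMeasSubmodule Ω := ⟨fun _ => 1, isBddMeas_const 1⟩
  have he : e ≠ 0 := by
    intro h
    obtain ⟨ω⟩ := nonempty_of_isProbabilityMeasure P
    exact one_ne_zero (congrFun (congrArg Subtype.val h) ω)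
  obtain ⟨g, hg, hgs⟩ := riesz_extension (separationCone P L k h0 hL hLadd hLsmul)
    (LinearPMap.mkSpanSingleton e (1 : ℝ) he) (by
      rintro ⟨x, hx⟩ hxs
      obtain ⟨c, rfl⟩ := Submodule.mem_span_singleton.1 hx
      refine le_of_le_of_eq ?_ (LinearPMap.mkSpanSingleton'_apply e (1 : ℝ) _ c hx).symm
      rw [smul_eq_mul, mul_one]
      obtain ⟨X, hX, t, hae, hkt⟩ := hxs
      simp only [e, Submodule.coe_smul, Pi.smul_apply, smul_eq_mul, mul_one, integral_const,
        probReal_univ] at hae hkt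
      have := hLk X hX (c + t) (hae.mono fun ω hω => by linarith)
      have h1 : 0 ≤ c * (1 + k) := by linarith
      exact nonneg_of_mul_nonneg_left h1 (by linarith)) (by
      intro y
      obtain ⟨M, hM⟩ := y.2.2
      refine ⟨⟨M • e, Submodule.smul_mem _ _ (Submodule.mem_span_singleton_self e)⟩, 0, h0, 0,
        ae_of_all _ fun ω => ?_, ?_⟩
      · simp only [e, Submodule.coe_add, Submodule.coe_smul, Pi.add_apply, Pi.smul_apply,
          smul_eq_mul, Pi.zero_apply]
        linarith [(abs_le.1 (hM ω)).1]
      · simp only [e, Submodule.coe_add, Submodule.coe_smul, Pi.add_apply, Pi.smul_apply,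
          smul_eq_mul, Pi.zero_apply, integral_zero, mul_zero, add_zero]
        exact integral_nonneg fun ω => by
          simp only [Pi.zero_apply]
          linarith [(abs_le.1 (hM ω)).1])
  obtain ⟨ℓ, hℓ⟩ := LinearMap.exists_extend g
  have hℓg : ∀ f : bddMeasSubmodule Ω, ℓ f = g f := fun f => LinearMap.congr_fun hℓ f
  refine ⟨ℓ, ?_, fun f hf => (hℓg f).symm ▸ hgs f hf⟩
  have h1 := hg ⟨e, Submodule.mem_span_singleton_self e⟩
  exact (hℓg e).trans (h1.trans (LinearPMap.mkSpanSingleton_apply ℝ ℝ he (1 : ℝ)))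

theorem exists_isFAP_of_integral_le {Ω : Type*} [MeasurableSpace Ω] (P : Measure Ω)
    [IsProbabilityMeasure P] (L : Set (Ω → ℝ)) {k : ℝ} (hk : 0 ≤ k) (h0 : 0 ∈ L)
    (hL : ∀ X ∈ L, IsBddMeas X)
    (hLadd : ∀ X ∈ L, ∀ Y ∈ L, X + Y ∈ L) (hLsmul : ∀ X ∈ L, ∀ c : ℝ, 0 ≤ c → c • X ∈ L)
    (hLk : ∀ X ∈ L, ∀ t : ℝ, (∀ᵐ ω ∂P, 0 ≤ X ω + t) → ∫ ω, X ω ∂P ≤ k * t) :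
    ∃ (ℓ : (Ω → ℝ) → ℝ) (r : ℝ), IsFAP ℓ ∧
      (∀ A : Set Ω, MeasurableSet A →
        (ℓ (A.indicator fun _ => (1 : ℝ)) = 0 ↔ P A = 0)) ∧
      (∀ X ∈ L, ℓ X ≤ 0) ∧ 0 < r ∧
      (∀ A : Set Ω, MeasurableSet A →
        r * (P A).toReal ≤ ℓ (A.indicator fun _ => (1 : ℝ))) := by
  obtain ⟨ℓ, hℓ1, hℓs⟩ :=
    exists_linearMap_nonneg_on_separationCone P L hk h0 hL hLadd hLsmul hLk
  have hk1 : 0 < 1 + k := by linarith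
  have hae : ∀ f : Ω → ℝ, IsBddMeas f → (∀ᵐ ω ∂P, 0 ≤ f ω) → 0 ≤ ℓ f := fun f hf hpos =>
    hℓs ⟨f, hf⟩ ⟨0, h0, 0, by simpa using hpos, by
      simpa using integral_nonneg_of_ae hpos⟩
  have hlow : ∀ A : Set Ω, MeasurableSet A →
      (1 + k)⁻¹ * (P A).toReal ≤ ℓ (A.indicator fun _ => (1 : ℝ)) := by
    intro A hA
    set c := (1 + k)⁻¹ * (P A).toReal with hc
    have hck : (1 + k) * c = (P A).toReal := by
      rw [hc]; field_simp
    have hi := isBddMeas_indicator hA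
    have hcb := (isBddMeas_const (Ω := Ω) 1).smul (-c)
    have h1 := hℓs ⟨_, hi.add hcb⟩ ⟨0, h0, c, ae_of_all _ fun ω => by
      simpa using Set.indicator_nonneg (fun _ _ => zero_le_one) ω, by
      have h2 : ∫ ω, A.indicator (fun _ => (1 : ℝ)) ω ∂P = (P A).toReal :=
        integral_indicator_one hA
      simp only [Pi.add_apply]
      rw [integral_add (hi.integrable P) (hcb.integrable P), h2]
      simp only [Pi.smul_apply, smul_eq_mul, mul_one, integral_const, probReal_univ,
        Pi.zero_apply, mul_zero, add_zero]
      linarith⟩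
    simp only [map_add, map_smul, hℓ1, smul_eq_mul, mul_one] at h1
    linarith
  refine ⟨ℓ, (1 + k)⁻¹, ⟨fun f g _ _ => map_add ℓ f g, fun c f _ => map_smul ℓ c f,
    fun f g hf hg hfg => ?_, hℓ1⟩, fun A hA => ⟨fun h => ?_, fun h => ?_⟩, fun X hX => ?_,
    inv_pos.2 hk1, hlow⟩
  · have h1 := hae (g + (-1 : ℝ) • f) (hg.add (hf.smul _)) (ae_of_all _ fun ω => by
      simpa using hfg ω)
    simp only [map_add, map_smul, smul_eq_mul] at h1
    linarith
  · have h1 := hlow A hA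
    rw [h] at h1
    have h2 : (P A).toReal ≤ 0 := nonpos_of_mul_nonpos_right h1 (inv_pos.2 hk1)
    exact (measureReal_eq_zero_iff).1 (le_antisymm h2 ENNReal.toReal_nonneg)
  · have hi := isBddMeas_indicator hA
    have h1 := hae _ hi (ae_of_all _ fun ω => Set.indicator_nonneg (fun _ _ => zero_le_one) ω)
    have h2 := hae _ (hi.smul (-1)) (by
      filter_upwards [measure_eq_zero_iff_ae_notMem.1 h] with ω hω
      simp [hω])
    simp only [map_smul, smul_eq_mul] at h2
    linarith
  · have h1 := hℓs ⟨_, (hL X hX).smul (-1)⟩ ⟨X, hX, 0, ae_of_all _ fun ω => by simp, by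
      simp [integral_neg]⟩
    simp only [map_smul, smul_eq_mul] at h1
    linarith

/-- **Corollary.** For a convex cone `L` of bounded random variables:
condition (b) holds with `Q = P₀`, i.e. `E_{P₀}(X) ≤ k·ess sup(−X)` for all `X ∈ L` and
some `k ≥ 0`, if and only if there is an ESFA `ℓ` with `ℓ ≥ r·P₀` for some `r > 0`. -/
theorem stmt_11 {Ω : Type*} [MeasurableSpace Ω] (P₀ : Measure Ω) [IsProbabilityMeasure P₀]
    (L : Set (Ω → ℝ)) (hLmeas : ∀ X ∈ L, Measurable X)
    (hLbdd : ∀ X ∈ L, ∃ M : ℝ, ∀ ω, |X ω| ≤ M)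
    (hLadd : ∀ X ∈ L, ∀ Y ∈ L, X + Y ∈ L)
    (hLsmul : ∀ X ∈ L, ∀ c : ℝ, 0 ≤ c → c • X ∈ L) :
    (∃ k : ℝ, 0 ≤ k ∧ ∀ X ∈ L, ∫ ω, X ω ∂P₀ ≤ k * essSupR P₀ (fun ω => -X ω)) ↔
    (∃ (ℓ : (Ω → ℝ) → ℝ) (r : ℝ), IsFAP ℓ ∧
      (∀ A : Set Ω, MeasurableSet A →
        (ℓ (A.indicator fun _ => (1 : ℝ)) = 0 ↔ P₀ A = 0)) ∧
      (∀ X ∈ L, ℓ X ≤ 0) ∧ 0 < r ∧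
      (∀ A : Set Ω, MeasurableSet A →
        r * (P₀ A).toReal ≤ ℓ (A.indicator fun _ => (1 : ℝ)))) := by
  have hB : ∀ X ∈ L, IsBddMeas X := fun X hX => ⟨hLmeas X hX, hLbdd X hX⟩
  constructor
  · rintro ⟨k, hk, hLk⟩
    obtain ⟨ℓ, r, hℓ, hnull, hneg, hr, hlow⟩ :=
      exists_isFAP_of_integral_le P₀ (insert 0 L) hk (Set.mem_insert 0 L)
        (by
          rintro X (rfl | hX)
          exacts [isBddMeas_const 0, hB X hX])
        (by
          rintro X (rfl | hX) Y (rfl | hY)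
          · simp
          · simp [hY]
          · simp [hX]
          · exact Or.inr (hLadd X hX Y hY))
        (by
          rintro X (rfl | hX) c hc
          · simp
          · exact Or.inr (hLsmul X hX c hc))
        (by
          rintro X (rfl | hX) t ht
          · obtain ⟨ω, hω⟩ := ht.exists
            simpa using mul_nonneg hk (by simpa using hω)
          · exact (hLk X hX).trans
              (mul_le_mul_of_nonneg_left (essSupR_neg_le P₀ (hB X hX) ht) hk))
    exact ⟨ℓ, r, hℓ, hnull, fun X hX => hneg X (Or.inr hX), hr, hlow⟩
  · rintro ⟨ℓ, r, hℓ, hnull, hneg, hr, hlow⟩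
    refine ⟨r⁻¹, (inv_pos.2 hr).le, fun X hX => ?_⟩
    rw [le_inv_mul_iff₀ hr]
    exact hℓ.mul_integral_le_essSupR_neg P₀ hr hlow (fun A hA => (hnull A hA).2) (hB X hX)
      (hneg X hX)
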